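/- Let f : ℝ → ℝ be twice continuously differentiable with f''(v) > 0 for all v in an interval J containing u₂ and u₃, where u₂ ≠ u₃. Let x₂ < x₂₃ < x₃ be real numbers. Extend the nonlinear average by a(w,w) = w. Then there exists a unique value v strictly between u₂ and u₃ satisfying the area-conservation condition for particle insertion: (x₂₃ − x₂)·a(u₂, v) + (x₃ − x₂₃)·a(v, u₃) = (x₃ − x₂)·a(u₂, u₃). -/

import Mathlib

open Set Filter Topology

/-- The nonlinear average associated with the flux `f`, equal to the identity on the diagonal. -/
noncomputable def nonlinearAverage (f : ℝ → ℝ) (p q : ℝ) : ℝ :=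
  if p = q then p else
    ((deriv f q * q - f q) - (deriv f p * p - f p)) / (deriv f q - deriv f p)

namespace nonlinearAverage

variable {f : ℝ → ℝ} {p q s l r : ℝ}

lemma self (f : ℝ → ℝ) (p : ℝ) : nonlinearAverage f p p = p := by
  simp [nonlinearAverage]

lemma symm (f : ℝ → ℝ) (p q : ℝ) : nonlinearAverage f p q = nonlinearAverage f q p := by
  by_cases h : p = q
  · rw [h]
  · rw [nonlinearAverage, nonlinearAverage, if_neg h, if_neg (Ne.symm h),
      ← neg_sub (deriv f p * p - f p), ← neg_sub (deriv f p) (deriv f q), neg_div_neg_eq]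

lemma mul_sub_eq (hpq : p ≠ q) (hd : deriv f p ≠ deriv f q) :
    nonlinearAverage f p q * (deriv f q - deriv f p) =
      (deriv f q * q - f q) - (deriv f p * p - f p) := by
  rw [nonlinearAverage, if_neg hpq, div_mul_cancel₀ _ (sub_ne_zero.2 hd.symm)]

lemma mem_Ioo (hf : Differentiable ℝ f) (hg : StrictMonoOn (deriv f) (Icc p q)) (hpq : p < q) :
    nonlinearAverage f p q ∈ Ioo p q := by
  obtain ⟨c, hc, hcs⟩ := exists_deriv_eq_slope f hpq hf.continuous.continuousOn
    hf.differentiableOn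
  have hpc := hg (left_mem_Icc.2 hpq.le) (Ioo_subset_Icc_self hc) hc.1
  have hcq := hg (Ioo_subset_Icc_self hc) (right_mem_Icc.2 hpq.le) hc.2
  rw [eq_div_iff (sub_pos.2 hpq).ne'] at hcs
  have hpos : 0 < deriv f q - deriv f p := by linarith
  rw [nonlinearAverage, if_neg hpq.ne, Set.mem_Ioo, lt_div_iff₀ hpos, div_lt_iff₀ hpos]
  constructor <;> nlinarith

/-- The average over an interval lies strictly between the averages over its two parts. -/
lemma lt_and_lt (hf : Differentiable ℝ f) (hg : StrictMonoOn (deriv f) (Icc p s))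
    (hpq : p < q) (hqs : q < s) :
    nonlinearAverage f p q < nonlinearAverage f p s ∧
      nonlinearAverage f p s < nonlinearAverage f q s := by
  have hps := hpq.trans hqs
  have h1 := (mem_Ioo hf (hg.mono (Icc_subset_Icc_right hqs.le)) hpq).2
  have h2 := (mem_Ioo hf (hg.mono (Icc_subset_Icc_left hpq.le)) hqs).1
  have hq : q ∈ Icc p s := ⟨hpq.le, hqs.le⟩
  have g1 := hg (left_mem_Icc.2 hps.le) hq hpq
  have g2 := hg hq (right_mem_Icc.2 hps.le) hqs
  have e1 := mul_sub_eq hpq.ne g1.ne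
  have e2 := mul_sub_eq hqs.ne g2.ne
  have e3 := mul_sub_eq hps.ne (g1.trans g2).ne
  have hlt := h1.trans h2
  constructor
  · refine lt_of_mul_lt_mul_right ?_ (sub_pos.2 (g1.trans g2)).le
    nlinarith [mul_pos (sub_pos.2 hlt) (sub_pos.2 g2)]
  · refine lt_of_mul_lt_mul_right ?_ (sub_pos.2 (g1.trans g2)).le
    nlinarith [mul_pos (sub_pos.2 hlt) (sub_pos.2 g1)]

lemma strictMonoOn_right (hf : Differentiable ℝ f) (hg : StrictMonoOn (deriv f) (Icc l r)) :
    StrictMonoOn (fun v => nonlinearAverage f l v) (Icc l r) := by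
  intro q hq s hs hqs
  have hg' := hg.mono (Icc_subset_Icc_right hs.2)
  rcases hq.1.eq_or_lt with rfl | hlq
  · simpa only [self] using (mem_Ioo hf hg' hqs).1
  · exact (lt_and_lt hf hg' hlq hqs).1

lemma strictMonoOn_left (hf : Differentiable ℝ f) (hg : StrictMonoOn (deriv f) (Icc l r)) :
    StrictMonoOn (fun v => nonlinearAverage f v r) (Icc l r) := by
  intro q hq s hs hqs
  have hg' := hg.mono (Icc_subset_Icc_left hq.1)
  rcases hs.2.eq_or_lt with rfl | hsr
  · simpa only [self] using (mem_Ioo hf hg' hqs).2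
  · exact (lt_and_lt hf hg' hqs hsr).2

/-- The average is continuous in one argument on intervals where `deriv f` is strictly increasing. -/
lemma continuousOn (hf : Differentiable ℝ f) (hc : Continuous (deriv f))
    (hg : StrictMonoOn (deriv f) (Icc l r)) (hp : p ∈ Icc l r) :
    ContinuousOn (nonlinearAverage f p) (Icc l r) := by
  intro q hq
  by_cases hqp : q = p
  · subst hqp
    rw [ContinuousWithinAt, self]
    have hmin : Tendsto (fun v => min q v) (𝓝[Icc l r] q) (𝓝 q) := by
      have h : Continuous fun v => min q v := by fun_prop
      simpa using (h.tendsto q).mono_left nhdsWithin_le_nhds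
    have hmax : Tendsto (fun v => max q v) (𝓝[Icc l r] q) (𝓝 q) := by
      have h : Continuous fun v => max q v := by fun_prop
      simpa using (h.tendsto q).mono_left nhdsWithin_le_nhds
    have key : ∀ v ∈ Icc l r, nonlinearAverage f q v ∈ Icc (min q v) (max q v) := by
      intro v hv
      rcases lt_trichotomy q v with h | rfl | h
      · rw [min_eq_left h.le, max_eq_right h.le]
        exact Ioo_subset_Icc_self (mem_Ioo hf (hg.mono (Icc_subset_Icc hq.1 hv.2)) h)
      · simp [self]
      · rw [min_eq_right h.le, max_eq_left h.le, symm]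
        exact Ioo_subset_Icc_self (mem_Ioo hf (hg.mono (Icc_subset_Icc hv.1 hq.2)) h)
    exact tendsto_of_tendsto_of_tendsto_of_le_of_le' hmin hmax
      (eventually_mem_nhdsWithin.mono fun v hv => (key v hv).1)
      (eventually_mem_nhdsWithin.mono fun v hv => (key v hv).2)
  · have hne : deriv f q - deriv f p ≠ 0 :=
      sub_ne_zero.2 fun h => hqp (hg.injOn hq hp h)
    have hquot : ContinuousAt (fun v => ((deriv f v * v - f v) - (deriv f p * p - f p)) /
        (deriv f v - deriv f p)) q := by
      have hfc := hf.continuous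
      exact ContinuousAt.div (by fun_prop) (by fun_prop) hne
    refine (hquot.congr ?_).continuousWithinAt
    filter_upwards [isOpen_ne.mem_nhds hqp] with v hv
    rw [nonlinearAverage, if_neg (Ne.symm hv)]

/-- A weighted average condition with positive weights has a unique interior solution. -/
lemma existsUnique_weighted (hf : Differentiable ℝ f) (hc : Continuous (deriv f))
    (hg : StrictMonoOn (deriv f) (Icc l r)) (hlr : l < r) {α β : ℝ} (hα : 0 < α) (hβ : 0 < β) :
    ∃! v : ℝ, v ∈ Ioo l r ∧
      α * nonlinearAverage f l v + β * nonlinearAverage f v r =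
        (α + β) * nonlinearAverage f l r := by
  set F : ℝ → ℝ := fun v => α * nonlinearAverage f l v + β * nonlinearAverage f v r with hF
  have hmono : StrictMonoOn F (Icc l r) := fun x hx y hy hxy =>
    add_lt_add (mul_lt_mul_of_pos_left (strictMonoOn_right hf hg hx hy hxy) hα)
      (mul_lt_mul_of_pos_left (strictMonoOn_left hf hg hx hy hxy) hβ)
  have hcont : ContinuousOn F (Icc l r) := by
    have h1 := continuousOn hf hc hg (left_mem_Icc.2 hlr.le)
    have h2 := continuousOn hf hc hg (right_mem_Icc.2 hlr.le)
    simp only [hF, symm f _ r]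
    exact (continuousOn_const.mul h1).add (continuousOn_const.mul h2)
  have hm := mem_Ioo hf hg hlr
  have hmem : (α + β) * nonlinearAverage f l r ∈ Ioo (F l) (F r) := by
    simp only [hF, self, Set.mem_Ioo]
    constructor <;> nlinarith [mul_lt_mul_of_pos_left hm.1 hα, mul_lt_mul_of_pos_left hm.2 hβ]
  obtain ⟨v, hv, hFv⟩ := intermediate_value_Ioo hlr.le hcont hmem
  refine ⟨v, ⟨hv, hFv⟩, fun w ⟨hw, hFw⟩ => ?_⟩
  exact hmono.injOn (Ioo_subset_Icc_self hw) (Ioo_subset_Icc_self hv) (hFw.trans hFv.symm)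

end nonlinearAverage


/-- Existence and uniqueness of the inserted particle value. For a convex C²
flux, particles `(x₂,u₂)`, `(x₃,u₃)` with `u₂ ≠ u₃`, and an insertion position
`x₂ < x₂₃ < x₃`, there is a unique value `v` strictly between `u₂` and `u₃` conserving
the area under the piecewise similarity interpolant. -/
theorem insertion_value_exists_unique
    (f : ℝ → ℝ) (hf : ContDiff ℝ 2 f)
    (J : Set ℝ) (hJ : J.OrdConnected)
    (hconv : ∀ w ∈ J, 0 < deriv (deriv f) w)
    (u₂ u₃ : ℝ) (h₂ : u₂ ∈ J) (h₃ : u₃ ∈ J) (h23 : u₂ ≠ u₃)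
    (x₂ x₂₃ x₃ : ℝ) (hx₂ : x₂ < x₂₃) (hx₃ : x₂₃ < x₃)
    (a : ℝ → ℝ → ℝ)
    (ha : a = fun p q => if p = q then p else
      ((deriv f q * q - f q) - (deriv f p * p - f p)) / (deriv f q - deriv f p)) :
    ∃! v : ℝ, v ∈ Set.Ioo (min u₂ u₃) (max u₂ u₃) ∧
      (x₂₃ - x₂) * a u₂ v + (x₃ - x₂₃) * a v u₃ = (x₃ - x₂) * a u₂ u₃ := by
  have hdiff : Differentiable ℝ f := hf.differentiable (by norm_num)
  have hc : Continuous (deriv f) := hf.continuous_deriv (by norm_num)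
  have hg : ∀ {l r : ℝ}, l ∈ J → r ∈ J → StrictMonoOn (deriv f) (Icc l r) := fun hl hr =>
    strictMonoOn_of_deriv_pos (convex_Icc _ _) hc.continuousOn fun w hw =>
      hconv w (hJ.out hl hr (interior_subset hw))
  replace ha : a = nonlinearAverage f := ha
  subst ha
  rcases h23.lt_or_gt with h | h
  · rw [min_eq_left h.le, max_eq_right h.le, ← sub_add_sub_cancel' x₂₃ x₂ x₃]
    exact nonlinearAverage.existsUnique_weighted hdiff hc (hg h₂ h₃) h
      (sub_pos.2 hx₂) (sub_pos.2 hx₃)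
  · rw [min_eq_right h.le, max_eq_left h.le]
    have key := nonlinearAverage.existsUnique_weighted hdiff hc (hg h₃ h₂) h
      (sub_pos.2 hx₃) (sub_pos.2 hx₂)
    refine (existsUnique_congr fun v => and_congr_right fun _ => ?_).mp key
    rw [nonlinearAverage.symm f u₃ v, nonlinearAverage.symm f v u₂,
      nonlinearAverage.symm f u₃ u₂, add_comm, sub_add_sub_cancel]
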